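/- Let λ > 0 and σ_v > 0. Then for every κ ∈ ℝ, ∫_{−∞}^{κ} g(t) dt = 1 − F(−κ), where F(x) = Φ(x/σ_v) − exp(−λx + λ²σ_v²/2) · Φ(x/σ_v − λσ_v) is the cdf of the exponentially modified Gaussian distribution with Gaussian mean 0, Gaussian standard deviation σ_v and rate λ, and g is the exponential composed error density. -/

import Mathlib

open Real MeasureTheory

/-- Standard normal density. -/
noncomputable def stdNormalPdf (x : ℝ) : ℝ := Real.exp (-x ^ 2 / 2) / Real.sqrt (2 * Real.pi)

/-- Standard normal cumulative distribution function. -/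
noncomputable def stdNormalCdf (x : ℝ) : ℝ := ∫ t in Set.Iic x, stdNormalPdf t

/-- Exponential composed error density. -/
noncomputable def expComposedErrorPdf (lam σv t : ℝ) : ℝ :=
  lam * Real.exp (lam * t + σv ^ 2 * lam ^ 2 / 2) * stdNormalCdf (-t / σv - lam * σv)

/-- CDF of the exponentially modified Gaussian distribution with Gaussian mean 0,
Gaussian standard deviation `σv` and rate `lam`. -/
noncomputable def emgCdf (lam σv x : ℝ) : ℝ :=
  stdNormalCdf (x / σv) -
    Real.exp (-(lam * x) + lam ^ 2 * σv ^ 2 / 2) * stdNormalCdf (x / σv - lam * σv)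

theorem stdNormalPdf_eq_gaussianPDFReal :
    stdNormalPdf = ProbabilityTheory.gaussianPDFReal 0 1 := by
  ext x
  simp [stdNormalPdf, ProbabilityTheory.gaussianPDFReal, div_eq_inv_mul]

theorem integrable_stdNormalPdf : Integrable stdNormalPdf := by
  rw [stdNormalPdf_eq_gaussianPDFReal]
  exact ProbabilityTheory.integrable_gaussianPDFReal 0 1

theorem integral_stdNormalPdf : ∫ x, stdNormalPdf x = 1 := by
  rw [stdNormalPdf_eq_gaussianPDFReal]
  exact ProbabilityTheory.integral_gaussianPDFReal_eq_one 0 one_ne_zero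

theorem stdNormalPdf_nonneg (x : ℝ) : 0 ≤ stdNormalPdf x := by
  unfold stdNormalPdf
  positivity

theorem continuous_stdNormalPdf : Continuous stdNormalPdf := by
  unfold stdNormalPdf
  fun_prop

theorem stdNormalCdf_nonneg (x : ℝ) : 0 ≤ stdNormalCdf x :=
  integral_nonneg stdNormalPdf_nonneg

theorem stdNormalCdf_le_one (x : ℝ) : stdNormalCdf x ≤ 1 := by
  rw [← integral_stdNormalPdf]
  exact setIntegral_le_integral integrable_stdNormalPdf (ae_of_all _ stdNormalPdf_nonneg)

theorem tendsto_stdNormalCdf_atTop :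
    Filter.Tendsto stdNormalCdf Filter.atTop (nhds 1) := by
  rw [← integral_stdNormalPdf]
  exact (aecover_Iic Filter.tendsto_id).integral_tendsto_of_countably_generated
    integrable_stdNormalPdf

theorem hasDerivAt_stdNormalCdf (x : ℝ) :
    HasDerivAt stdNormalCdf (stdNormalPdf x) x := by
  have hcdf : stdNormalCdf = fun y => stdNormalCdf 0 + ∫ t in (0 : ℝ)..y, stdNormalPdf t := by
    ext y
    rw [← intervalIntegral.integral_Iic_sub_Iic integrable_stdNormalPdf.integrableOn
      integrable_stdNormalPdf.integrableOn]
    simp [stdNormalCdf]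
  rw [hcdf]
  exact (continuous_stdNormalPdf.integral_hasStrictDerivAt 0 x).hasDerivAt.const_add _

theorem continuous_stdNormalCdf : Continuous stdNormalCdf :=
  continuous_iff_continuousAt.2 fun x => (hasDerivAt_stdNormalCdf x).continuousAt

/-- Completing the square in the Gaussian density. -/
theorem exp_mul_stdNormalPdf_sub (lam : ℝ) {σv : ℝ} (hσv : σv ≠ 0) (x : ℝ) :
    Real.exp (-(lam * x) + lam ^ 2 * σv ^ 2 / 2) * stdNormalPdf (x / σv - lam * σv) =
      stdNormalPdf (x / σv) := by
  unfold stdNormalPdf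
  rw [← mul_div_assoc, ← Real.exp_add]
  congr 2
  field_simp
  ring

theorem hasDerivAt_emgCdf (lam : ℝ) {σv : ℝ} (hσv : σv ≠ 0) (x : ℝ) :
    HasDerivAt (emgCdf lam σv) (expComposedErrorPdf lam σv (-x)) x := by
  have hdiv : HasDerivAt (fun y : ℝ => y / σv) (1 / σv) x := (hasDerivAt_id x).div_const σv
  have hexp : HasDerivAt (fun y : ℝ => Real.exp (-(lam * y) + lam ^ 2 * σv ^ 2 / 2))
      (Real.exp (-(lam * x) + lam ^ 2 * σv ^ 2 / 2) * -(lam * 1)) x :=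
    ((((hasDerivAt_id x).const_mul lam).neg).add_const _).exp
  have hderiv := ((hasDerivAt_stdNormalCdf (x / σv)).comp x hdiv).sub
    (hexp.mul ((hasDerivAt_stdNormalCdf (x / σv - lam * σv)).comp x (hdiv.sub_const (lam * σv))))
  refine hderiv.congr_deriv ?_
  have hsq := exp_mul_stdNormalPdf_sub lam hσv x
  have harg : lam * -x + σv ^ 2 * lam ^ 2 / 2 = -(lam * x) + lam ^ 2 * σv ^ 2 / 2 := by ring
  simp only [Function.comp_apply, expComposedErrorPdf, neg_neg, harg]
  linear_combination (-(1 / σv)) * hsq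

theorem tendsto_emgCdf_atTop {lam σv : ℝ} (hlam : 0 < lam) (hσv : 0 < σv) :
    Filter.Tendsto (emgCdf lam σv) Filter.atTop (nhds 1) := by
  have hdiv : Filter.Tendsto (fun x : ℝ => x / σv) Filter.atTop Filter.atTop :=
    Filter.tendsto_id.atTop_div_const hσv
  have hexp : Filter.Tendsto (fun x : ℝ => Real.exp (-(lam * x) + lam ^ 2 * σv ^ 2 / 2))
      Filter.atTop (nhds 0) :=
    Real.tendsto_exp_atBot.comp <| Filter.tendsto_atBot_add_const_right _ _ <|
      Filter.tendsto_neg_atTop_atBot.comp (Filter.tendsto_id.const_mul_atTop hlam)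
  have hshift : Filter.Tendsto (fun x : ℝ => x / σv - lam * σv) Filter.atTop Filter.atTop :=
    Filter.tendsto_atTop_add_const_right _ (-(lam * σv)) hdiv
  have hlim := (tendsto_stdNormalCdf_atTop.comp hdiv).sub
    (hexp.mul (tendsto_stdNormalCdf_atTop.comp hshift))
  rw [zero_mul, sub_zero] at hlim
  exact hlim

theorem integrableOn_expComposedErrorPdf_Iic {lam : ℝ} (hlam : 0 < lam) (σv κ : ℝ) :
    IntegrableOn (expComposedErrorPdf lam σv) (Set.Iic κ) := by
  have hexp : IntegrableOn
      (fun t => lam * Real.exp (lam * t + σv ^ 2 * lam ^ 2 / 2)) (Set.Iic κ) := by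
    simp only [Real.exp_add]
    exact ((integrableOn_exp_mul_Iic hlam κ).mul_const _).const_mul _
  refine hexp.mul_bdd (c := 1) ?_ (ae_of_all _ fun t => ?_)
  · exact (continuous_stdNormalCdf.comp (by fun_prop)).aestronglyMeasurable
  · rw [Real.norm_of_nonneg (stdNormalCdf_nonneg _)]
    exact stdNormalCdf_le_one _

theorem stmt5 (lam σv : ℝ) (hlam : 0 < lam) (hσv : 0 < σv) (κ : ℝ) :
    (∫ t in Set.Iic κ, expComposedErrorPdf lam σv t) = 1 - emgCdf lam σv (-κ) := by
  have hderiv (t : ℝ) :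
      HasDerivAt (fun y => 1 - emgCdf lam σv (-y)) (expComposedErrorPdf lam σv t) t := by
    have hneg := ((hasDerivAt_emgCdf lam hσv.ne' (-t)).comp t (hasDerivAt_neg t)).const_sub 1
    simpa using! hneg
  have hlim := ((tendsto_emgCdf_atTop hlam hσv).comp Filter.tendsto_neg_atBot_atTop).const_sub 1
  rw [integral_Iic_of_hasDerivAt_of_tendsto' (fun t _ => hderiv t)
    (integrableOn_expComposedErrorPdf_Iic hlam σv κ) hlim]
  simp
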